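/- Let l_n denote the number of pure λυ-terms (equivalently, λυ-terms that ψ-normalise in 0 normal-order steps) of size n, and let t_n denote the total number of λυ-terms of size n. Then l_n/t_n → 0 as n → ∞; that is, the asymptotic density μ_0 of ψ-normal forms among all λυ-terms is 0. -/

import Mathlib

mutual
/-- λυ-terms in de Bruijn notation, with explicit closures. -/
inductive LTerm : Type
  | idx : Nat → LTerm
  | lam : LTerm → LTerm
  | app : LTerm → LTerm → LTerm
  | clos : LTerm → LSub → LTerm
  deriving DecidableEq

/-- explicit λυ-substitutions. -/
inductive LSub : Type
  | slash : LTerm → LSub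
  | lift : LSub → LSub
  | shift : LSub
  deriving DecidableEq
end

mutual
/-- natural size of a λυ-term: the number of constructors (|idx n| = n+1). -/
def LTerm.size : LTerm → Nat
  | .idx n => n + 1
  | .lam a => 1 + a.size
  | .app a b => 1 + a.size + b.size
  | .clos a s => 1 + a.size + s.size

/-- natural size of a substitution. -/
def LSub.size : LSub → Nat
  | .slash a => 1 + a.size
  | .lift s => 1 + s.size
  | .shift => 1
end

/-- a λυ-term is pure if it contains no closure; pure terms are exactly the ψ-normal forms. -/
def LTerm.IsPure : LTerm → Prop
  | .idx _ => True
  | .lam a => a.IsPure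
  | .app a b => a.IsPure ∧ b.IsPure
  | .clos _ _ => False

/-- one normal-order (leftmost-outermost) ψ-reduction step. -/
inductive NStep : LTerm → LTerm → Prop
  /-- (App) (ab)[s] → a[s](b[s]) -/
  | appS (a b : LTerm) (s : LSub) :
      NStep (.clos (.app a b) s) (.app (.clos a s) (.clos b s))
  /-- (Lambda) (λa)[s] → λ(a[⇑(s)]) -/
  | lamS (a : LTerm) (s : LSub) :
      NStep (.clos (.lam a) s) (.lam (.clos a (.lift s)))
  /-- (FVar) 0[a/] → a -/
  | fvar (a : LTerm) : NStep (.clos (.idx 0) (.slash a)) a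
  /-- (RVar) (S n)[a/] → n -/
  | rvar (n : Nat) (a : LTerm) : NStep (.clos (.idx (n+1)) (.slash a)) (.idx n)
  /-- (FVarLift) 0[⇑(s)] → 0 -/
  | fvarLift (s : LSub) : NStep (.clos (.idx 0) (.lift s)) (.idx 0)
  /-- (RVarLift) (S n)[⇑(s)] → n[s][↑] -/
  | rvarLift (n : Nat) (s : LSub) :
      NStep (.clos (.idx (n+1)) (.lift s)) (.clos (.clos (.idx n) s) .shift)
  /-- (VarShift) n[↑] → S n -/
  | varShift (n : Nat) : NStep (.clos (.idx n) .shift) (.idx (n+1))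
  /-- reduce under an abstraction -/
  | lamCong {a a' : LTerm} : NStep a a' → NStep (.lam a) (.lam a')
  /-- reduce in the left part of an application -/
  | appLeft {a a' : LTerm} (b : LTerm) : NStep a a' → NStep (.app a b) (.app a' b)
  /-- reduce in the right part of an application, provided the left part is normal -/
  | appRight {b b' : LTerm} (a : LTerm) :
      a.IsPure → NStep b b' → NStep (.app a b) (.app a b')
  /-- reduce in the body of a closure, provided the closure is not itself a ψ-redex,
      i.e. its body is again a closure -/
  | closCong {t t' : LTerm} (s : LSub) :
      (∃ u v, t = LTerm.clos u v) → NStep t t' → NStep (.clos t s) (.clos t' s)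

/-- `NormIn t k` : `t` reaches its ψ-normal form in exactly `k` normal-order
ψ-reduction steps (written t ↓_k). -/
inductive NormIn : LTerm → Nat → Prop
  | base {t : LTerm} : t.IsPure → NormIn t 0
  | step {t t' : LTerm} {k : Nat} : NStep t t' → NormIn t' k → NormIn t (k+1)

/-- the number l_n of pure λυ-terms (equivalently, λυ-terms that ψ-normalise
in 0 normal-order steps) of size n. -/
noncomputable def pureCount (n : ℕ) : ℕ :=
  Nat.card {t : LTerm // t.IsPure ∧ t.size = n}

/-- the total number t_n of λυ-terms of size n. -/
noncomputable def termCount (n : ℕ) : ℕ :=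
  Nat.card {t : LTerm // t.size = n}

/-- Adds one to the size of a term; the values are exactly the terms that are neither
`idx 0`, an abstraction nor an application. -/
def LTerm.bump : LTerm → LTerm
  | .idx n => .idx (n + 1)
  | .lam a => .clos a .shift
  | .app a b => .clos a (.slash b)
  | .clos a s => .clos a (.lift s)

/-- Encodes nonempty binary trees with `n` nodes as λυ-terms of size `n`
(the value at `nil` is irrelevant). -/
def LTerm.ofTree : BinaryTree Unit → LTerm
  | .nil => .idx 0
  | .node _ .nil .nil => .idx 0
  | .node _ .nil (.node u l r) => (LTerm.ofTree (.node u l r)).bump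
  | .node _ (.node u l r) .nil => .lam (LTerm.ofTree (.node u l r))
  | .node _ (.node u l r) (.node u' l' r') =>
      .app (LTerm.ofTree (.node u l r)) (LTerm.ofTree (.node u' l' r'))

theorem LTerm.size_bump (t : LTerm) : t.bump.size = t.size + 1 := by
  cases t <;> simp only [LTerm.bump, LTerm.size, LSub.size] <;> omega

theorem LTerm.bump_injective : Function.Injective LTerm.bump := by
  intro t t' h
  cases t <;> cases t' <;> simp_all [LTerm.bump]

theorem LTerm.size_ofTree (t : BinaryTree Unit) (ht : t ≠ .nil) :
    (LTerm.ofTree t).size = t.numNodes := by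
  fun_induction LTerm.ofTree t <;>
    simp_all [LTerm.size, LTerm.size_bump, BinaryTree.numNodes] <;> omega

theorem LTerm.ofTree_injOn : Set.InjOn LTerm.ofTree {t | t ≠ .nil} := by
  have bump_ne_idx (t : LTerm) : t.bump ≠ .idx 0 := by cases t <;> simp [LTerm.bump]
  have bump_ne_lam (t a : LTerm) : t.bump ≠ .lam a := by cases t <;> simp [LTerm.bump]
  have bump_ne_app (t a b : LTerm) : t.bump ≠ .app a b := by cases t <;> simp [LTerm.bump]
  intro t ht t' ht' h
  simp only [Set.mem_ofPred_eq] at ht ht'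
  induction t generalizing t' with
  | nil => exact absurd rfl ht
  | node _ l r hl hr =>
    cases t' with
    | nil => exact absurd rfl ht'
    | node _ l' r' =>
      cases l <;> cases r <;> cases l' <;> cases r' <;>
        simp only [LTerm.ofTree, LTerm.bump_injective.eq_iff, bump_ne_idx, bump_ne_lam,
          bump_ne_app, (bump_ne_idx _).symm, (bump_ne_lam _ _).symm, (bump_ne_app _ _ _).symm,
          LTerm.lam.injEq, LTerm.app.injEq, reduceCtorEq] at h <;>
        first
        | rfl
        | rw [hl (by simp) (by simp) h.1, hr (by simp) (by simp) h.2]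
        | rw [hl (by simp) (by simp) h]
        | rw [hr (by simp) (by simp) h]

theorem finite_size_le (n : ℕ) :
    {t : LTerm | t.size ≤ n}.Finite ∧ {s : LSub | s.size ≤ n}.Finite := by
  induction n with
  | zero =>
    constructor
    · convert Set.finite_empty
      ext t
      cases t <;> simp [LTerm.size]
    · convert Set.finite_empty
      ext s
      cases s <;> simp [LSub.size]
  | succ n ih =>
    obtain ⟨ht, hs⟩ := ih
    constructor
    · refine ((((Set.finite_le_nat n).image LTerm.idx).union (ht.image LTerm.lam)).union
        ((ht.image2 LTerm.app ht).union (ht.image2 LTerm.clos hs))).subset ?_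
      intro t h
      cases t <;> simp only [LTerm.size, Set.mem_ofPred_eq] at h <;> simp <;> omega
    · refine (((ht.image LSub.slash).union (hs.image LSub.lift)).union
        (Set.finite_singleton LSub.shift)).subset ?_
      intro s h
      cases s <;> simp only [LSub.size, Set.mem_ofPred_eq] at h <;> simp <;> omega

theorem catalan_le_termCount {n : ℕ} (hn : 0 < n) : catalan n ≤ termCount n := by
  have hfin : {t : LTerm | t.size = n}.Finite :=
    (finite_size_le n).1.subset fun t ht => le_of_eq ht
  have hnil {t : BinaryTree Unit} (ht : t.numNodes = n) : t ≠ .nil := by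
    rintro rfl
    simp at ht
    omega
  rw [← BinaryTree.treesOfNumNodesEq_card_eq_catalan, ← Set.ncard_coe_finset,
    BinaryTree.coe_treesOfNumNodesEq]
  change _ ≤ Set.ncard {t : LTerm | t.size = n}
  refine Set.ncard_le_ncard_of_injOn LTerm.ofTree ?_ ?_ hfin
  · intro t ht
    exact (LTerm.size_ofTree t (hnil ht)).trans ht
  · exact LTerm.ofTree_injOn.mono fun t ht => hnil ht

/-- A finite set of pure terms containing all those of size at most `n`. -/
def pureTerms : ℕ → Finset LTerm
  | 0 => ∅
  | n + 1 => (Finset.range (n + 1)).image LTerm.idx ∪ ((pureTerms n).image LTerm.lam ∪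
      (pureTerms n ×ˢ pureTerms n).image fun p => .app p.1 p.2)

theorem mem_pureTerms {t : LTerm} (ht : t.IsPure) {n : ℕ} (hn : t.size ≤ n) :
    t ∈ pureTerms n := by
  induction n generalizing t with
  | zero => cases t <;> simp [LTerm.size] at hn
  | succ n ih =>
    cases t with
    | idx k =>
      simp only [LTerm.size] at hn
      simp [pureTerms]
      omega
    | lam a =>
      simp only [LTerm.size] at hn
      simpa [pureTerms] using ih (t := a) ht (by omega)
    | app a b =>
      simp only [LTerm.size] at hn
      simpa [pureTerms] using ⟨ih ht.1 (by omega), ih ht.2 (by omega)⟩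
    | clos a s => exact ht.elim

theorem sum_union_le_of_nonneg {ι : Type*} [DecidableEq ι] (s t : Finset ι) {f : ι → ℝ}
    (hf : ∀ i, 0 ≤ f i) : ∑ i ∈ s ∪ t, f i ≤ ∑ i ∈ s, f i + ∑ i ∈ t, f i := by
  rw [← Finset.sum_union_inter]
  exact le_add_of_nonneg_right (Finset.sum_nonneg fun i _ => hf i)

theorem sum_pureTerms_le_one (n : ℕ) :
    ∑ t ∈ pureTerms n, (2 / 7 : ℝ) ^ t.size ≤ 1 := by
  induction n with
  | zero => simp [pureTerms]
  | succ n ih =>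
    set M := ∑ t ∈ pureTerms n, (2 / 7 : ℝ) ^ t.size with hM
    have hM0 : 0 ≤ M := Finset.sum_nonneg fun _ _ => by positivity
    have hpos (t : LTerm) : 0 ≤ (2 / 7 : ℝ) ^ t.size := by positivity
    have hidx : ∑ t ∈ (Finset.range (n + 1)).image LTerm.idx, (2 / 7 : ℝ) ^ t.size ≤ 2 / 5 := by
      refine (Finset.sum_image_le_of_nonneg fun t _ => hpos t).trans ?_
      simp only [LTerm.size, pow_succ]
      rw [← Finset.sum_mul, geom_sum_eq (by norm_num)]
      have : (0 : ℝ) ≤ (2 / 7) ^ (n + 1) := by positivity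
      rw [show (2 / 7 - 1 : ℝ) = -(5 / 7) by norm_num]
      linarith
    have hlam : ∑ t ∈ (pureTerms n).image LTerm.lam, (2 / 7 : ℝ) ^ t.size ≤ 2 / 7 * M := by
      refine (Finset.sum_image_le_of_nonneg fun t _ => hpos t).trans_eq ?_
      simp only [LTerm.size, pow_add, pow_one, ← Finset.mul_sum, hM]
    have happ : ∑ t ∈ (pureTerms n ×ˢ pureTerms n).image fun p => LTerm.app p.1 p.2,
        (2 / 7 : ℝ) ^ t.size ≤ 2 / 7 * (M * M) := by
      refine (Finset.sum_image_le_of_nonneg fun t _ => hpos t).trans_eq ?_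
      rw [hM, Finset.sum_mul_sum, ← Finset.sum_product', Finset.mul_sum]
      simp only [LTerm.size, pow_add, pow_one, mul_assoc]
    rw [pureTerms]
    have h₁ := sum_union_le_of_nonneg ((Finset.range (n + 1)).image LTerm.idx)
      ((pureTerms n).image LTerm.lam ∪
        (pureTerms n ×ˢ pureTerms n).image fun p => LTerm.app p.1 p.2) hpos
    have h₂ := sum_union_le_of_nonneg ((pureTerms n).image LTerm.lam)
      ((pureTerms n ×ˢ pureTerms n).image fun p => LTerm.app p.1 p.2) hpos
    nlinarith

theorem pureCount_le (n : ℕ) : (pureCount n : ℝ) ≤ (7 / 2) ^ n := by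
  have hcard : pureCount n ≤ ((pureTerms n).filter fun t => t.size = n).card := by
    rw [← Set.ncard_coe_finset]
    change Set.ncard {t : LTerm | t.IsPure ∧ t.size = n} ≤ _
    refine Set.ncard_le_ncard ?_ (Finset.finite_toSet _)
    rintro t ⟨ht, hn⟩
    simpa [hn] using mem_pureTerms ht hn.le
  have hsum : (((pureTerms n).filter fun t => t.size = n).card : ℝ) * (2 / 7) ^ n ≤ 1 := by
    refine le_trans (le_of_eq ?_) ((Finset.sum_le_sum_of_subset_of_nonneg
      (Finset.filter_subset (fun t : LTerm => t.size = n) _)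
      fun t _ _ => by positivity).trans (sum_pureTerms_le_one n))
    rw [← nsmul_eq_mul, ← Finset.sum_const]
    exact Finset.sum_congr rfl fun t ht => by rw [(Finset.mem_filter.1 ht).2]
  have h : (pureCount n : ℝ) * (2 / 7) ^ n ≤ 1 :=
    (mul_le_mul_of_nonneg_right (Nat.cast_le.2 hcard) (by positivity)).trans hsum
  rw [← le_div_iff₀ (by positivity)] at h
  rwa [one_div, ← inv_pow, inv_div] at h

theorem four_pow_le_mul_termCount {n : ℕ} (hn : 0 < n) :
    (4 : ℝ) ^ n ≤ 4 * n ^ 2 * termCount n := by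
  have h : 4 ^ n ≤ 4 * n ^ 2 * termCount n := calc
    4 ^ n ≤ 2 * n * n.centralBinom := Nat.four_pow_le_two_mul_self_mul_centralBinom n hn
    _ = 2 * n * ((n + 1) * catalan n) := by rw [succ_mul_catalan_eq_centralBinom]
    _ ≤ 2 * n * ((n + n) * termCount n) := by
      gcongr
      · exact hn
      · exact catalan_le_termCount hn
    _ = 4 * n ^ 2 * termCount n := by ring
  exact_mod_cast h

/-- The asymptotic density of ψ-normal forms (pure terms) among all λυ-terms
is 0: l_n/t_n → 0 as n → ∞. -/
theorem pure_density_zero :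
    Filter.Tendsto (fun n : ℕ => (pureCount n : ℝ) / (termCount n : ℝ))
      Filter.atTop (nhds 0) := by
  have hlim : Filter.Tendsto (fun n : ℕ => 4 * ((n : ℝ) ^ 2 * (7 / 8) ^ n))
      Filter.atTop (nhds 0) := by
    simpa using (tendsto_pow_const_mul_const_pow_of_lt_one 2 (r := (7 / 8 : ℝ))
      (by norm_num) (by norm_num)).const_mul 4
  refine squeeze_zero' (Filter.Eventually.of_forall fun n => by positivity) ?_ hlim
  filter_upwards [Filter.eventually_gt_atTop 0] with n hn
  have hT := four_pow_le_mul_termCount hn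
  have hpos : (0 : ℝ) < termCount n := by
    by_contra! hneg
    have : (0 : ℝ) < 4 ^ n := by positivity
    nlinarith [sq_nonneg (n : ℝ)]
  rw [div_le_iff₀ hpos]
  calc (pureCount n : ℝ) ≤ (7 / 2) ^ n := pureCount_le n
    _ = (7 / 8) ^ n * 4 ^ n := by rw [← mul_pow]; norm_num
    _ ≤ (7 / 8) ^ n * (4 * n ^ 2 * termCount n) := by gcongr
    _ = 4 * ((n : ℝ) ^ 2 * (7 / 8) ^ n) * termCount n := by ring
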